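/- For all f, g in Thompson's group F, p_{f∘g} = f · p_g, that is, p_{f∘g} = f(p_g ∩ E_f) ∪ f((C ∖ p_g) ∩ (C ∖ E_f)). In particular, the formula f · p = f(p ∩ E_f) ∪ f((C ∖ p) ∩ (C ∖ E_f)) defines an action of F on Ω₂ corresponding, under the bijection F/H₂ ≅ Ω₂, to the action of F on F/H₂ by left translations. -/

import Mathlib

open Set MeasureTheory Filter Topology

/-- The binary Cantor space. -/
abbrev CantorC : Type := ℕ → Bool

/-- Finite binary words. -/
abbrev BWord : Type := List Bool

/-- Prepend a finite word to an infinite binary sequence. -/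
def wordApp (w : BWord) (x : CantorC) : CantorC := fun n =>
  if h : n < w.length then w.get ⟨n, h⟩ else x (n - w.length)

/-- The cylinder of sequences beginning with the word `w`. -/
def cyl (w : BWord) : Set CantorC := Set.range (wordApp w)

/-- `J` is a code: both the α-cylinders and the β-cylinders form a partition of the
Cantor space (every point lies in the cylinder of exactly one pair). -/
def IsCode (J : Finset (BWord × BWord)) : Prop :=
  (∀ x : CantorC, ∃! p : BWord × BWord, p ∈ J ∧ x ∈ cyl p.1) ∧
  (∀ x : CantorC, ∃! p : BWord × BWord, p ∈ J ∧ x ∈ cyl p.2)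

/-- `J` is order preserving: α ≺ α' lexicographically iff β ≺ β' lexicographically. -/
def OrdPres (J : Finset (BWord × BWord)) : Prop :=
  ∀ p ∈ J, ∀ q ∈ J, (List.Lex (· < ·) p.1 q.1 ↔ List.Lex (· < ·) p.2 q.2)

/-- The bijection `g` is induced by the code `J` : it maps `β·x` to `α·x`. -/
def InducedBy (J : Finset (BWord × BWord)) (g : Equiv.Perm CantorC) : Prop :=
  ∀ p ∈ J, ∀ x : CantorC, g (wordApp p.2 x) = wordApp p.1 x

/-- `J` is an order-preserving code inducing the bijection `g`. -/
def IsCodeFor (J : Finset (BWord × BWord)) (g : Equiv.Perm CantorC) : Prop :=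
  IsCode J ∧ OrdPres J ∧ InducedBy J g

/-- Membership in (the realization on the Cantor space of) Thompson's group `F`. -/
def InF (g : Equiv.Perm CantorC) : Prop := ∃ J, IsCodeFor J g

/-- The pair `(α, β)` has `|α| ≡ |β| (mod 2)`. -/
def EvenPair (p : BWord × BWord) : Prop := p.1.length % 2 = p.2.length % 2

/-- Membership in the subgroup `H₂` : some order-preserving code for `g` has all
pairs of even length difference. -/
def InH2 (g : Equiv.Perm CantorC) : Prop :=
  ∃ J, IsCodeFor J g ∧ ∀ p ∈ J, EvenPair p

/-- The union of the α-cylinders over pairs of even length difference. -/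
def pSet (J : Finset (BWord × BWord)) : Set CantorC :=
  {x | ∃ p ∈ J, EvenPair p ∧ x ∈ cyl p.1}

/-- The union of the β-cylinders over pairs of even length difference. -/
def eSet (J : Finset (BWord × BWord)) : Set CantorC :=
  {x | ∃ p ∈ J, EvenPair p ∧ x ∈ cyl p.2}

/-- `p_f` : for `f ∈ F` this equals `pSet J` for any (equivalently, every)
order-preserving code `J` for `f`. -/
def pF (g : Equiv.Perm CantorC) : Set CantorC :=
  ⋃ J ∈ {J : Finset (BWord × BWord) | IsCodeFor J g}, pSet J

/-- `E_f` : for `f ∈ F` this equals `eSet J` for any (equivalently, every)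
order-preserving code `J` for `f`. -/
def EF (g : Equiv.Perm CantorC) : Set CantorC :=
  ⋃ J ∈ {J : Finset (BWord × BWord) | IsCodeFor J g}, eSet J

/-- `Ω₂ = {p_f : f ∈ F}`. -/
def Omega2 : Set (Set CantorC) := {p | ∃ g, InF g ∧ pF g = p}

/-- The action `f · p = f(p ∩ E_f) ∪ f((C ∖ p) ∩ (C ∖ E_f))`. -/
def actF (g : Equiv.Perm CantorC) (p : Set CantorC) : Set CantorC :=
  g '' (p ∩ EF g) ∪ g '' (pᶜ ∩ (EF g)ᶜ)

open Classical in
/-- `T(p)` as a Boolean-valued characteristic function: `T(p) w = true` iff the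
cylinder of `w` meets `p`. -/
noncomputable def Tb (p : Set CantorC) : BWord → Bool :=
  fun w => if (cyl w ∩ p).Nonempty then true else false

/-- The embedding `p ↦ (T(p), T(C ∖ p))`. -/
noncomputable def embedT (p : Set CantorC) : (BWord → Bool) × (BWord → Bool) :=
  (Tb p, Tb pᶜ)

/-- `Ω̄₂` : the closure of the image of `Ω₂` under the embedding. -/
noncomputable def OmegaBar : Set ((BWord → Bool) × (BWord → Bool)) :=
  closure (embedT '' Omega2)

/-- The lexicographic order on the Cantor space. -/
def seqLt (x y : CantorC) : Prop := toLex x < toLex y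

/-- `f` replaces the initial word `b` by the initial word `a`. -/
def Rewrites (f : Equiv.Perm CantorC) (a b : BWord) : Prop :=
  ∀ y, f (wordApp b y) = wordApp a y

lemma wordApp_apply_lt {w : BWord} {n : ℕ} (h : n < w.length) (x : CantorC) :
    wordApp w x n = w[n] := by
  simp [wordApp, h]

lemma wordApp_apply_length_add (w : BWord) (x : CantorC) (n : ℕ) :
    wordApp w x (w.length + n) = x n := by
  simp [wordApp]

@[simp] lemma wordApp_nil (x : CantorC) : wordApp [] x = x := by
  funext n
  simp [wordApp]

@[simp] lemma wordApp_cons_zero (a : Bool) (w : BWord) (x : CantorC) :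
    wordApp (a :: w) x 0 = a := by
  simp [wordApp]

@[simp] lemma wordApp_cons_succ (a : Bool) (w : BWord) (x : CantorC) (n : ℕ) :
    wordApp (a :: w) x (n + 1) = wordApp w x n := by
  simp [wordApp]

lemma wordApp_append (u v : BWord) (x : CantorC) :
    wordApp (u ++ v) x = wordApp u (wordApp v x) := by
  induction u with
  | nil => simp
  | cons a u ih =>
    funext n
    cases n with
    | zero => simp
    | succ n => simp [ih]

lemma wordApp_mem_cyl (w : BWord) (x : CantorC) : wordApp w x ∈ cyl w := ⟨x, rfl⟩

/-- The initial word of length `n` of a sequence. -/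
def initWord (x : CantorC) (n : ℕ) : BWord := List.ofFn fun i : Fin n => x i

@[simp] lemma length_initWord (x : CantorC) (n : ℕ) : (initWord x n).length = n := by
  simp [initWord]

lemma mem_cyl_initWord (x : CantorC) (n : ℕ) : x ∈ cyl (initWord x n) := by
  refine ⟨fun k => x (n + k), ?_⟩
  funext k
  by_cases h : k < n
  · rw [wordApp_apply_lt (by simpa using h)]
    simp [initWord]
  · obtain ⟨m, rfl⟩ := Nat.exists_eq_add_of_le (not_lt.1 h)
    simpa using wordApp_apply_length_add (initWord x n) (fun k => x (n + k)) m

lemma prefix_of_mem_cyl {u v : BWord} {x : CantorC} (hu : x ∈ cyl u) (hv : x ∈ cyl v)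
    (h : u.length ≤ v.length) : u <+: v := by
  obtain ⟨y, rfl⟩ := hu
  obtain ⟨z, hz⟩ := hv
  rw [List.prefix_iff_getElem]
  refine ⟨h, fun n hn => ?_⟩
  rw [← wordApp_apply_lt hn y, ← hz, wordApp_apply_lt]

lemma eq_of_mem_cyl {u v : BWord} {x : CantorC} (hu : x ∈ cyl u) (hv : x ∈ cyl v)
    (h : u.length = v.length) : u = v :=
  (prefix_of_mem_cyl hu hv h.le).eq_of_length h

lemma cyl_subset_of_prefix {u v : BWord} (h : u <+: v) : cyl v ⊆ cyl u := by
  obtain ⟨w, rfl⟩ := h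
  rintro _ ⟨x, rfl⟩
  rw [wordApp_append]
  exact wordApp_mem_cyl _ _

lemma length_le_of_wordApp_eq {u v : BWord} (h : ∀ y, wordApp u y = wordApp v y) :
    v.length ≤ u.length := by
  by_contra! hlt
  have hu := wordApp_apply_length_add u (fun _ => !v[u.length]) 0
  rw [h, Nat.add_zero, wordApp_apply_lt hlt] at hu
  simp at hu

lemma length_eq_of_wordApp_eq {u v : BWord} (h : ∀ y, wordApp u y = wordApp v y) :
    u.length = v.length :=
  le_antisymm (length_le_of_wordApp_eq fun y => (h y).symm) (length_le_of_wordApp_eq h)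

lemma seqLt_cons (a b : Bool) (u v : BWord) (x y : CantorC) :
    seqLt (wordApp (a :: u) x) (wordApp (b :: v) y) ↔
      a < b ∨ a = b ∧ seqLt (wordApp u x) (wordApp v y) := by
  constructor
  · rintro ⟨n, hn, hlt⟩
    cases n with
    | zero => exact Or.inl (by simpa using hlt)
    | succ n =>
      refine Or.inr ⟨by simpa using hn 0 n.succ_pos, n, fun k hk => ?_, by simpa using hlt⟩
      simpa using hn (k + 1) (Nat.succ_lt_succ hk)
  · rintro (h | ⟨rfl, n, hn, hlt⟩)
    · exact ⟨0, fun k hk => absurd hk k.not_lt_zero, by simpa using h⟩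
    · refine ⟨n + 1, fun k hk => ?_, by simpa using hlt⟩
      cases k with
      | zero => simp
      | succ k => simpa using hn k (Nat.lt_of_succ_lt_succ hk)

lemma seqLt_wordApp (w : BWord) (x y : CantorC) :
    seqLt (wordApp w x) (wordApp w y) ↔ seqLt x y := by
  induction w with
  | nil => simp
  | cons a w ih => simp [seqLt_cons, ih]

lemma lex_iff_seqLt {u v : BWord} (huv : ¬ u <+: v) (hvu : ¬ v <+: u) (x y : CantorC) :
    List.Lex (· < ·) u v ↔ seqLt (wordApp u x) (wordApp v y) := by
  induction u generalizing v with
  | nil => exact absurd List.nil_prefix huv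
  | cons a u ih =>
    cases v with
    | nil => exact absurd List.nil_prefix hvu
    | cons b v =>
      rw [List.cons_prefix_cons] at huv hvu
      rw [List.cons_lex_cons_iff, seqLt_cons]
      by_cases hab : a = b
      · subst hab
        rw [ih (by simpa using huv) (by simpa using hvu)]
      · simp [hab]

lemma not_prefix_of_disjoint {u v : BWord} (h : Disjoint (cyl u) (cyl v)) : ¬ u <+: v :=
  fun hp => Set.disjoint_left.1 h
    (cyl_subset_of_prefix hp (wordApp_mem_cyl v fun _ => false)) (wordApp_mem_cyl v _)

lemma lex_iff_seqLt_of_disjoint {u v : BWord} (h : Disjoint (cyl u) (cyl v)) (x y : CantorC) :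
    List.Lex (· < ·) u v ↔ seqLt (wordApp u x) (wordApp v y) :=
  lex_iff_seqLt (not_prefix_of_disjoint h) (not_prefix_of_disjoint h.symm) x y

lemma Rewrites.append {f : Equiv.Perm CantorC} {a b : BWord} (h : Rewrites f a b) (w : BWord) :
    Rewrites f (a ++ w) (b ++ w) := fun y => by
  rw [wordApp_append, wordApp_append, h]

lemma Rewrites.mul {f g : Equiv.Perm CantorC} {a b c : BWord} (hf : Rewrites f a b)
    (hg : Rewrites g b c) : Rewrites (f * g) a c := fun y => by
  rw [Equiv.Perm.mul_apply, hg, hf]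

lemma Rewrites.length_add_eq_of_le {f : Equiv.Perm CantorC} {a b a' b' : BWord} {x : CantorC}
    (h : Rewrites f a b) (h' : Rewrites f a' b') (hx : x ∈ cyl b) (hx' : x ∈ cyl b')
    (hle : b.length ≤ b'.length) : a.length + b'.length = a'.length + b.length := by
  obtain ⟨w, rfl⟩ := prefix_of_mem_cyl hx hx' hle
  have hlen := length_eq_of_wordApp_eq fun y => ((h.append w) y).symm.trans (h' y)
  simp only [List.length_append] at hlen ⊢
  omega

lemma Rewrites.length_add_eq {f : Equiv.Perm CantorC} {a b a' b' : BWord} {x : CantorC}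
    (h : Rewrites f a b) (h' : Rewrites f a' b') (hx : x ∈ cyl b) (hx' : x ∈ cyl b') :
    a.length + b'.length = a'.length + b.length := by
  rcases le_total b.length b'.length with hle | hle
  · exact h.length_add_eq_of_le h' hx hx' hle
  · exact (h'.length_add_eq_of_le h hx' hx hle).symm

lemma InF.exists_rewrites {f : Equiv.Perm CantorC} (hf : InF f) :
    ∃ N, ∀ b : BWord, N ≤ b.length → ∃ a, Rewrites f a b := by
  obtain ⟨J, hJ, -, hind⟩ := hf
  refine ⟨J.sup fun p => p.2.length, fun b hb => ?_⟩
  obtain ⟨p, ⟨hp, hmem⟩, -⟩ := hJ.2 (wordApp b fun _ => false)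
  have hle : p.2.length ≤ b.length :=
    (Finset.le_sup (f := fun p : BWord × BWord => p.2.length) hp).trans hb
  obtain ⟨w, rfl⟩ := prefix_of_mem_cyl hmem (wordApp_mem_cyl _ _) hle
  exact ⟨p.1 ++ w, Rewrites.append (hind p hp) w⟩

lemma InF.exists_rewrites_comp {f g : Equiv.Perm CantorC} (hf : InF f) (hg : InF g) :
    ∃ N, ∀ c : BWord, N ≤ c.length → ∃ a b, Rewrites f a b ∧ Rewrites g b c := by
  obtain ⟨M, hM⟩ := hf.exists_rewrites
  obtain ⟨N, hN⟩ := hg.exists_rewrites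
  refine ⟨N + M, fun c hc => ?_⟩
  obtain ⟨b, hb⟩ := hN (c.take N) (by simp; omega)
  obtain ⟨a, ha⟩ := hM (b ++ c.drop N) (by simp; omega)
  refine ⟨a, _, ha, ?_⟩
  simpa using hb.append (c.drop N)

lemma IsCode.disjoint_fst {J : Finset (BWord × BWord)} (hJ : IsCode J) {p q : BWord × BWord}
    (hp : p ∈ J) (hq : q ∈ J) (hne : p ≠ q) : Disjoint (cyl p.1) (cyl q.1) :=
  Set.disjoint_left.2 fun x hx hx' => hne ((hJ.1 x).unique ⟨hp, hx⟩ ⟨hq, hx'⟩)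

lemma IsCode.disjoint_snd {J : Finset (BWord × BWord)} (hJ : IsCode J) {p q : BWord × BWord}
    (hp : p ∈ J) (hq : q ∈ J) (hne : p ≠ q) : Disjoint (cyl p.2) (cyl q.2) :=
  Set.disjoint_left.2 fun x hx hx' => hne ((hJ.2 x).unique ⟨hp, hx⟩ ⟨hq, hx'⟩)

lemma InF.seqLt_iff {f : Equiv.Perm CantorC} (hf : InF f) (x y : CantorC) :
    seqLt (f x) (f y) ↔ seqLt x y := by
  obtain ⟨J, hJ, hord, hind⟩ := hf
  obtain ⟨p, ⟨hp, x, rfl⟩, -⟩ := hJ.2 x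
  obtain ⟨q, ⟨hq, y, rfl⟩, -⟩ := hJ.2 y
  rw [hind p hp, hind q hq]
  by_cases hpq : p = q
  · subst hpq
    rw [seqLt_wordApp, seqLt_wordApp]
  · rw [← lex_iff_seqLt_of_disjoint (hJ.disjoint_fst hp hq hpq),
      ← lex_iff_seqLt_of_disjoint (hJ.disjoint_snd hp hq hpq)]
    exact hord p hp q hq

lemma inF_of_rewrites {f : Equiv.Perm CantorC} (hmono : ∀ x y, seqLt (f x) (f y) ↔ seqLt x y)
    {N : ℕ} (hN : ∀ b : BWord, N ≤ b.length → ∃ a, Rewrites f a b) : InF f := by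
  classical
  choose! a ha using hN
  let J : Finset (BWord × BWord) :=
    Finset.univ.image fun v : Fin N → Bool => (a (List.ofFn v), List.ofFn v)
  have mem_J (p) : p ∈ J ↔ p.2.length = N ∧ p.1 = a p.2 := by
    simp only [J, Finset.mem_image, Finset.mem_univ, true_and]
    constructor
    · rintro ⟨v, rfl⟩
      simp
    · rintro ⟨h, h'⟩
      subst h
      exact ⟨p.2.get, by simp [Prod.ext_iff, h']⟩
  have hind : InducedBy J f := by
    intro p hp x
    rw [mem_J] at hp
    rw [hp.2]
    exact ha _ hp.1.ge x
  have hsnd (x) : ∃! p : BWord × BWord, p ∈ J ∧ x ∈ cyl p.2 := by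
    refine ⟨(a (initWord x N), initWord x N), ⟨by simp [mem_J], mem_cyl_initWord x N⟩, ?_⟩
    rintro p ⟨hp, hx⟩
    rw [mem_J] at hp
    have h := eq_of_mem_cyl hx (mem_cyl_initWord x N) (by simp [hp.1])
    exact Prod.ext (by rw [hp.2, h]) h
  have hfst_iff (x) (p) (hp : p ∈ J) : x ∈ cyl p.1 ↔ f.symm x ∈ cyl p.2 := by
    constructor
    · rintro ⟨y, rfl⟩
      rw [← hind p hp, Equiv.symm_apply_apply]
      exact wordApp_mem_cyl _ _
    · rintro ⟨y, hy⟩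
      rw [← f.apply_symm_apply x, ← hy, hind p hp]
      exact wordApp_mem_cyl _ _
  have hJ : IsCode J := by
    refine ⟨fun x => ?_, hsnd⟩
    have h : (fun p => p ∈ J ∧ x ∈ cyl p.1) = fun p => p ∈ J ∧ f.symm x ∈ cyl p.2 :=
      funext fun p => propext (and_congr_right (hfst_iff x p))
    show ExistsUnique fun p => p ∈ J ∧ x ∈ cyl p.1
    rw [h]
    exact hsnd (f.symm x)
  refine ⟨J, hJ, fun p hp q hq => ?_, hind⟩
  by_cases hpq : p = q
  · subst hpq
    exact iff_of_false (List.lex_irrefl Bool.lt_irrefl _) (List.lex_irrefl Bool.lt_irrefl _)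
  · rw [lex_iff_seqLt_of_disjoint (hJ.disjoint_fst hp hq hpq) (fun _ => false) (fun _ => false),
      lex_iff_seqLt_of_disjoint (hJ.disjoint_snd hp hq hpq) (fun _ => false) (fun _ => false),
      ← hind p hp, ← hind q hq, hmono]

lemma InF.mul {f g : Equiv.Perm CantorC} (hf : InF f) (hg : InF g) : InF (f * g) := by
  obtain ⟨N, hN⟩ := hf.exists_rewrites_comp hg
  refine inF_of_rewrites (N := N) (fun x y => ?_) fun c hc => ?_
  · rw [Equiv.Perm.mul_apply, Equiv.Perm.mul_apply, hf.seqLt_iff, hg.seqLt_iff]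
  · obtain ⟨a, b, ha, hb⟩ := hN c hc
    exact ⟨a, ha.mul hb⟩

lemma inF_one : InF 1 :=
  inF_of_rewrites (N := 0) (fun _ _ => Iff.rfl) fun b _ => ⟨b, fun _ => rfl⟩

lemma InF.mem_EF_iff {f : Equiv.Perm CantorC} (hf : InF f) {a b : BWord} {x : CantorC}
    (h : Rewrites f a b) (hx : x ∈ cyl b) : x ∈ EF f ↔ EvenPair (a, b) := by
  simp only [EF, eSet, EvenPair, Set.mem_iUnion, Set.mem_ofPred_eq, exists_prop]
  constructor
  · rintro ⟨J, hJ, p, hp, heven, hxp⟩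
    have := h.length_add_eq (hJ.2.2 p hp) hx hxp
    omega
  · intro heven
    obtain ⟨J, hJ⟩ := hf
    obtain ⟨p, ⟨hp, hxp⟩, -⟩ := hJ.1.2 x
    have := h.length_add_eq (hJ.2.2 p hp) hx hxp
    exact ⟨J, hJ, p, hp, by omega, hxp⟩

lemma InducedBy.pSet_eq_image {J : Finset (BWord × BWord)} {f : Equiv.Perm CantorC}
    (h : InducedBy J f) : pSet J = f '' eSet J := by
  ext x
  constructor
  · rintro ⟨p, hp, heven, y, rfl⟩
    exact ⟨_, ⟨p, hp, heven, wordApp_mem_cyl _ y⟩, h p hp y⟩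
  · rintro ⟨_, ⟨p, hp, heven, y, rfl⟩, rfl⟩
    rw [h p hp]
    exact ⟨p, hp, heven, wordApp_mem_cyl _ y⟩

lemma pF_eq_image (f : Equiv.Perm CantorC) : pF f = f '' EF f := by
  rw [EF, Set.image_iUnion₂]
  exact Set.iUnion₂_congr fun J hJ => hJ.2.2.pSet_eq_image

lemma InF.mem_EF_mul {f g : Equiv.Perm CantorC} (hf : InF f) (hg : InF g) (x : CantorC) :
    x ∈ EF (f * g) ↔ (x ∈ EF g ↔ g x ∈ EF f) := by
  obtain ⟨N, hN⟩ := hf.exists_rewrites_comp hg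
  obtain ⟨a, b, ha, hb⟩ := hN (initWord x N) (by simp)
  have hx := mem_cyl_initWord x N
  have hgx : g x ∈ cyl b := by
    obtain ⟨y, hy⟩ := hx
    rw [← hy, hb]
    exact wordApp_mem_cyl _ _
  rw [(hf.mul hg).mem_EF_iff (ha.mul hb) hx, hg.mem_EF_iff hb hx, hf.mem_EF_iff ha hgx]
  simp only [EvenPair]
  omega

lemma EF_one : EF 1 = Set.univ :=
  Set.eq_univ_of_forall fun x =>
    (inF_one.mem_EF_iff (a := []) (b := []) (fun _ => rfl) ⟨x, wordApp_nil x⟩).2 rfl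

lemma pF_mul {f g : Equiv.Perm CantorC} (hf : InF f) (hg : InF g) :
    pF (f * g) = actF f (pF g) := by
  ext z
  obtain ⟨x, rfl⟩ := (f * g).surjective z
  simp only [actF, pF_eq_image, ← Set.image_union, Equiv.Perm.mul_apply]
  rw [← Equiv.Perm.mul_apply, (f * g).injective.mem_set_image, Equiv.Perm.mul_apply,
    f.injective.mem_set_image, hf.mem_EF_mul hg]
  simp only [Set.mem_union, Set.mem_inter_iff, Set.mem_compl_iff, g.injective.mem_set_image]
  tauto

/-- `p_{f∘g} = f · p_g`, and the formula `f · p` defines an action of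
`F` on `Ω₂` (corresponding to left translation on `F/H₂`). -/
theorem stmt6 :
    (∀ f g : Equiv.Perm CantorC, InF f → InF g → pF (f * g) = actF f (pF g)) ∧
    (∀ f : Equiv.Perm CantorC, InF f → ∀ p ∈ Omega2, actF f p ∈ Omega2) ∧
    (∀ p ∈ Omega2, actF (1 : Equiv.Perm CantorC) p = p) ∧
    (∀ f g : Equiv.Perm CantorC, InF f → InF g → ∀ p ∈ Omega2,
      actF (f * g) p = actF f (actF g p)) := by
  refine ⟨fun f g => pF_mul, ?_, ?_, ?_⟩
  · rintro f hf _ ⟨g, hg, rfl⟩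
    exact ⟨f * g, hf.mul hg, pF_mul hf hg⟩
  · intro p _
    simp [actF, EF_one]
  · rintro f g hf hg _ ⟨h, hh, rfl⟩
    rw [← pF_mul (hf.mul hg) hh, ← pF_mul hg hh, ← pF_mul hf (hg.mul hh), mul_assoc]
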